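/- arXiv:2505.23866 — 8 statements merged into one kernel-verified Lean document; each statement's English description precedes it below -/
import Mathlib

section
/- Let E be the Euclidean space ℝ^d, let ℓ : E → ℝ be twice continuously differentiable, let ρ > 0, and let θ ∈ E with ∇ℓ(θ) ≠ 0 and ‖∇ℓ(θ)‖ ≥ 1. Define the SAM-perturbed point θ̃ = θ + ρ ∇ℓ(θ)/‖∇ℓ(θ)‖. Suppose that for every point x on the segment joining θ and θ̃ and every vector v ∈ E, the Hessian quadratic form satisfies ∇²ℓ(x)[v, v] ≥ −(1/ρ)‖v‖². Then ℓ(θ̃) ≥ ℓ(θ) + ρ/2. -/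
/-- SAM ascent-step lower bound: if `‖∇ℓ(θ)‖ ≥ 1` and the Hessian quadratic form is bounded
below by `-(1/ρ)‖v‖²` on the segment joining `θ` and the SAM-perturbed point
`θ̃ = θ + ρ ∇ℓ(θ)/‖∇ℓ(θ)‖`, then `ℓ(θ̃) ≥ ℓ(θ) + ρ/2`. -/
theorem stmt_1 {d : ℕ} (ℓ : EuclideanSpace ℝ (Fin d) → ℝ) (hℓ : ContDiff ℝ 2 ℓ)
    (ρ : ℝ) (hρ : 0 < ρ) (θ θ' : EuclideanSpace ℝ (Fin d))
    (hgrad : gradient ℓ θ ≠ 0) (hgradnorm : 1 ≤ ‖gradient ℓ θ‖)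
    (hθ' : θ' = θ + (ρ / ‖gradient ℓ θ‖) • gradient ℓ θ)
    (hHess : ∀ x ∈ segment ℝ θ θ', ∀ v : EuclideanSpace ℝ (Fin d),
      iteratedFDeriv ℝ 2 ℓ x ![v, v] ≥ -(1 / ρ) * ‖v‖ ^ 2) :
    ℓ θ' ≥ ℓ θ + ρ / 2 := by
  set g := gradient ℓ θ with hg
  set w := (ρ / ‖g‖) • g with hw
  have hgpos : 0 < ‖g‖ := by linarith
  have hwn : ‖w‖ = ρ := by
    rw [hw, norm_smul, Real.norm_of_nonneg (by positivity)]
    field_simp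
  have hd1 : Differentiable ℝ ℓ := hℓ.differentiable (by norm_num)
  have hd2 : Differentiable ℝ (fderiv ℝ ℓ) :=
    (hℓ.fderiv_right (m := 1) (by norm_num)).differentiable (by norm_num)
  have hline : ∀ t : ℝ, HasDerivAt (fun t : ℝ => θ + t • w) w t := fun t => by
    simpa using ((hasDerivAt_id t).smul_const w).const_add θ
  have hf1 : ∀ t : ℝ, HasDerivAt (fun t : ℝ => ℓ (θ + t • w)) (fderiv ℝ ℓ (θ + t • w) w) t :=
    fun t => (hd1 (θ + t • w)).hasFDerivAt.comp_hasDerivAt t (hline t)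
  have hf2 : ∀ t : ℝ, HasDerivAt (fun t : ℝ => fderiv ℝ ℓ (θ + t • w) w)
      (fderiv ℝ (fderiv ℝ ℓ) (θ + t • w) w w) t := fun t => by
    have h := (hd2 (θ + t • w)).hasFDerivAt.comp_hasDerivAt t (hline t)
    simpa using h.clm_apply (hasDerivAt_const t w)
  have hH : ∀ t ∈ Set.Icc (0:ℝ) 1, -ρ ≤ fderiv ℝ (fderiv ℝ ℓ) (θ + t • w) w w := by
    intro t ht
    have hm : θ + t • w ∈ segment ℝ θ θ' := by
      rw [segment_eq_image', hθ']
      exact ⟨t, ht, by simp⟩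
    have h := hHess _ hm w
    rw [iteratedFDeriv_two_apply, hwn] at h
    have e : -(1 / ρ) * ρ ^ 2 = -ρ := by field_simp
    rw [e] at h
    simpa using h
  have h0 : fderiv ℝ ℓ θ w = ρ * ‖g‖ := by
    have h1 : fderiv ℝ ℓ θ w = inner ℝ g w := by
      rw [hg, gradient, InnerProductSpace.toDual_symm_apply]
    rw [h1, hw, real_inner_smul_right, real_inner_self_eq_norm_sq]
    field_simp
  have hd : ∀ t : ℝ, HasDerivAt (fun t : ℝ => fderiv ℝ ℓ (θ + t • w) w + ρ * t)
      (fderiv ℝ (fderiv ℝ ℓ) (θ + t • w) w w + ρ) t := fun t => by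
    have h := (hf2 t).add ((hasDerivAt_id t).const_mul ρ)
    exact h.congr_deriv (by simp)
  have hmono : MonotoneOn (fun t : ℝ => fderiv ℝ ℓ (θ + t • w) w + ρ * t) (Set.Icc 0 1) := by
    refine monotoneOn_of_deriv_nonneg (convex_Icc 0 1)
      (fun t _ => (hd t).continuousAt.continuousWithinAt)
      (fun t _ => (hd t).differentiableAt.differentiableWithinAt) ?_
    intro t ht
    rw [(hd t).deriv]
    linarith [hH t (interior_subset ht)]
  have hk : ∀ t : ℝ, HasDerivAt (fun t : ℝ => ℓ (θ + t • w) - ρ * t + ρ / 2 * t ^ 2)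
      (fderiv ℝ ℓ (θ + t • w) w - ρ + ρ * t) t := fun t => by
    have h := ((hf1 t).sub ((hasDerivAt_id t).const_mul ρ)).add
      ((hasDerivAt_pow 2 t).const_mul (ρ / 2))
    refine h.congr_deriv ?_
    simp
    ring
  have hmono2 : MonotoneOn (fun t : ℝ => ℓ (θ + t • w) - ρ * t + ρ / 2 * t ^ 2)
      (Set.Icc 0 1) := by
    refine monotoneOn_of_deriv_nonneg (convex_Icc 0 1)
      (fun t _ => (hk t).continuousAt.continuousWithinAt)
      (fun t _ => (hk t).differentiableAt.differentiableWithinAt) ?_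
    intro t ht
    rw [(hk t).deriv]
    have ht' := interior_subset ht
    have h := hmono (Set.left_mem_Icc.2 zero_le_one) ht' ht'.1
    simp only [zero_smul, add_zero, mul_zero, h0] at h
    nlinarith
  have h := hmono2 (Set.left_mem_Icc.2 zero_le_one) (Set.right_mem_Icc.2 zero_le_one) zero_le_one
  simp only [zero_smul, add_zero, mul_zero, one_smul] at h
  rw [hθ']
  linarith
end

section
/- (Lemma 1, 1-SAM version.) Let E be the Euclidean space ℝ^d, let p : E → ℝ be a strictly positive twice continuously differentiable function, and define the cross-entropy loss ℓ(θ) = −log p(θ). Let ρ > 0 and θ ∈ E with ∇ℓ(θ) ≠ 0 and ‖∇ℓ(θ)‖ ≥ 1, and set θ̃ = θ + ρ ∇ℓ(θ)/‖∇ℓ(θ)‖. Suppose that for every point x on the segment joining θ and θ̃ and every vector v ∈ E, the Hessian quadratic form of ℓ satisfies ∇²ℓ(x)[v, v] ≥ −(1/ρ)‖v‖². Then p(θ̃) ≤ e^{−ρ/2} p(θ). -/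
/-- Lemma 1 (1-SAM version): for the cross-entropy loss `ℓ = -log p` with `p > 0`,
under the SAM step `θ̃ = θ + ρ ∇ℓ(θ)/‖∇ℓ(θ)‖` with `‖∇ℓ(θ)‖ ≥ 1` and the Hessian
lower bound `-(1/ρ)‖v‖²` on the segment joining `θ` and `θ̃`,
we have `p(θ̃) ≤ e^{-ρ/2} p(θ)`. -/
theorem stmt_2 {d : ℕ} (p : EuclideanSpace ℝ (Fin d) → ℝ) (hp : ∀ x, 0 < p x)
    (hpC2 : ContDiff ℝ 2 p)
    (ℓ : EuclideanSpace ℝ (Fin d) → ℝ) (hℓ : ℓ = fun x => -Real.log (p x))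
    (ρ : ℝ) (hρ : 0 < ρ) (θ θ' : EuclideanSpace ℝ (Fin d))
    (hgrad : gradient ℓ θ ≠ 0) (hgradnorm : 1 ≤ ‖gradient ℓ θ‖)
    (hθ' : θ' = θ + (ρ / ‖gradient ℓ θ‖) • gradient ℓ θ)
    (hHess : ∀ x ∈ segment ℝ θ θ', ∀ v : EuclideanSpace ℝ (Fin d),
      iteratedFDeriv ℝ 2 ℓ x ![v, v] ≥ -(1 / ρ) * ‖v‖ ^ 2) :
    p θ' ≤ Real.exp (-ρ / 2) * p θ := by
  have hC : ContDiff ℝ 2 ℓ := by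
    rw [hℓ]
    exact (hpC2.log (fun x => (hp x).ne')).neg
  set g := gradient ℓ θ with hg
  have hn : 0 < ‖g‖ := norm_pos_iff.mpr hgrad
  set u : EuclideanSpace ℝ (Fin d) := (‖g‖)⁻¹ • g with hu
  have hun : ‖u‖ = 1 := by
    rw [hu, norm_smul, norm_inv, norm_norm, inv_mul_cancel₀ hn.ne']
  have hθu : θ' = θ + ρ • u := by
    rw [hθ', hu, smul_smul, div_eq_mul_inv]
  have hd1 : Differentiable ℝ ℓ := hC.differentiable (by norm_num)
  have hd2 : Differentiable ℝ (fderiv ℝ ℓ) :=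
    (hC.fderiv_right (m := 1) (by norm_num)).differentiable (by norm_num)
  have hline : ∀ t : ℝ, HasDerivAt (fun t : ℝ => θ + t • u) u t := by
    intro t
    simpa using ((hasDerivAt_id t).smul_const u).const_add θ
  have h1 : ∀ t : ℝ, HasDerivAt (fun t : ℝ => ℓ (θ + t • u)) (fderiv ℝ ℓ (θ + t • u) u) t :=
    fun t => (hd1 _).hasFDerivAt.comp_hasDerivAt t (hline t)
  have h2 : ∀ t : ℝ, HasDerivAt (fun t : ℝ => fderiv ℝ ℓ (θ + t • u) u)
      (fderiv ℝ (fderiv ℝ ℓ) (θ + t • u) u u) t := by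
    intro t
    have h := (hd2 (θ + t • u)).hasFDerivAt.comp_hasDerivAt t (hline t)
    simpa using h.clm_apply (hasDerivAt_const t u)
  have h3 : ∀ t ∈ Set.Icc (0 : ℝ) ρ, -(1 / ρ) ≤ fderiv ℝ (fderiv ℝ ℓ) (θ + t • u) u u := by
    intro t ht
    have hmem : θ + t • u ∈ segment ℝ θ θ' := by
      rw [segment_eq_image']
      refine ⟨t / ρ, ⟨div_nonneg ht.1 hρ.le, (div_le_one hρ).mpr ht.2⟩, ?_⟩
      simp only [hθu, add_sub_cancel_left, smul_smul, div_mul_cancel₀ _ hρ.ne']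
    have h := hHess _ hmem u
    rw [iteratedFDeriv_two_apply, hun] at h
    simpa using h
  have h0 : fderiv ℝ ℓ θ u = ‖g‖ := by
    have : fderiv ℝ ℓ θ u = inner ℝ g u := by
      rw [hg, gradient, InnerProductSpace.toDual_symm_apply]
    rw [this, hu, inner_smul_right, real_inner_self_eq_norm_sq]
    field_simp
  have k1 : ∀ t : ℝ, HasDerivAt (fun t : ℝ => fderiv ℝ ℓ (θ + t • u) u + t / ρ)
      (fderiv ℝ (fderiv ℝ ℓ) (θ + t • u) u u + 1 / ρ) t :=
    fun t => (h2 t).add ((hasDerivAt_id t).div_const ρ)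
  have m1 : MonotoneOn (fun t : ℝ => fderiv ℝ ℓ (θ + t • u) u + t / ρ) (Set.Icc 0 ρ) := by
    refine monotoneOn_of_deriv_nonneg (convex_Icc 0 ρ)
      (fun t _ => (k1 t).continuousAt.continuousWithinAt)
      (fun t _ => (k1 t).differentiableAt.differentiableWithinAt) ?_
    intro t ht
    rw [(k1 t).deriv]
    linarith [h3 t (interior_subset ht)]
  have k2 : ∀ t : ℝ, HasDerivAt (fun t : ℝ => ℓ (θ + t • u) + (t ^ 2 / (2 * ρ) - ‖g‖ * t))
      (fderiv ℝ ℓ (θ + t • u) u + (t / ρ - ‖g‖)) t := by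
    intro t
    refine (h1 t).add ?_
    have h := ((hasDerivAt_pow 2 t).div_const (2 * ρ)).sub ((hasDerivAt_id t).const_mul ‖g‖)
    have e : t / ρ - ‖g‖ = ((2 : ℕ) : ℝ) * t ^ (2 - 1) / (2 * ρ) - ‖g‖ * 1 := by
      norm_num
      field_simp
    rw [e]
    exact h
  have m2 : MonotoneOn (fun t : ℝ => ℓ (θ + t • u) + (t ^ 2 / (2 * ρ) - ‖g‖ * t))
      (Set.Icc 0 ρ) := by
    refine monotoneOn_of_deriv_nonneg (convex_Icc 0 ρ)
      (fun t _ => (k2 t).continuousAt.continuousWithinAt)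
      (fun t _ => (k2 t).differentiableAt.differentiableWithinAt) ?_
    intro t ht
    rw [(k2 t).deriv]
    have ht' := interior_subset ht
    have h := m1 (Set.left_mem_Icc.mpr hρ.le) ht' ht'.1
    simp only [zero_smul, add_zero, zero_div, h0] at h
    linarith
  have hfin := m2 (Set.left_mem_Icc.mpr hρ.le) (Set.right_mem_Icc.mpr hρ.le) hρ.le
  simp only [zero_smul, add_zero, ← hθu] at hfin
  have e : ρ ^ 2 / (2 * ρ) = ρ / 2 := by field_simp
  rw [e] at hfin
  have hl : ℓ θ + ρ / 2 ≤ ℓ θ' := by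
    have := mul_le_mul_of_nonneg_right hgradnorm hρ.le
    norm_num at hfin
    linarith
  simp only [hℓ] at hl
  rw [← Real.exp_log (hp θ'), ← Real.exp_log (hp θ), ← Real.exp_add]
  apply Real.exp_le_exp.mpr
  linarith
end

section
/- (Theorem 1, 1-SAM version, as a real inequality.) Let p, p̃ be real numbers with 0 < p̃ ≤ p < 1, and set λ = (1 − p̃)/(1 − p). Then −log p̃ ≥ −log p − λ H(p) + H(p̃), where H is the binary entropy function. -/
/-- The binary entropy function `H(q) = -q log q - (1-q) log (1-q)`. -/
noncomputable def binEntropy (q : ℝ) : ℝ := -q * Real.log q - (1 - q) * Real.log (1 - q)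

/-- Theorem 1 (1-SAM version), as a real inequality: for `0 < p̃ ≤ p < 1` and
`λ = (1-p̃)/(1-p)`, we have `-log p̃ ≥ -log p - λ H(p) + H(p̃)`. -/
theorem stmt_3 (p p' : ℝ) (hp' : 0 < p') (hpp' : p' ≤ p) (hp : p < 1) :
    -Real.log p' ≥ -Real.log p - (1 - p') / (1 - p) * binEntropy p + binEntropy p' := by
  have h1 : 0 < 1 - p := by linarith
  have hl : 1 ≤ (1 - p') / (1 - p) := by rw [le_div_iff₀ h1]; linarith
  have he : (1 - p') / (1 - p) * (1 - p) = 1 - p' := div_mul_cancel₀ _ h1.ne'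
  have e1 := Real.log_le_log hp' hpp'
  have e2 := Real.log_le_log h1 (by linarith : 1 - p ≤ 1 - p')
  have e3 : Real.log p ≤ 0 := Real.log_nonpos (by linarith) hp.le
  unfold binEntropy
  generalize (1 - p') / (1 - p) = l at *
  have a1 : 0 ≤ (1 - p') * (Real.log p - Real.log p') :=
    mul_nonneg (by linarith) (by linarith)
  have a2 : 0 ≤ (1 - p') * (Real.log (1 - p') - Real.log (1 - p)) :=
    mul_nonneg (by linarith) (by linarith)
  have a3 : 0 ≤ (l - 1) * (-Real.log p) := mul_nonneg (by linarith) (by linarith)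
  have k1 : l * (-p * Real.log p - (1 - p) * Real.log (1 - p))
      = (1 - p' - l) * Real.log p - (1 - p') * Real.log (1 - p) := by
    rw [← he]; ring
  rw [k1]
  linarith
end

section
/- Let p, p̃ be real numbers with 0 < p̃ ≤ p < 1. Then p̃ log(p/p̃) + (1 − p̃) log((1 − p)/(1 − p̃)) ≥ −((1 − p̃)/(1 − p)) H(p) + H(p̃), where H is the binary entropy function. -/
/-- Second inequality step in the proof of Theorem 1: for `0 < p̃ ≤ p < 1`,
`p̃ log(p/p̃) + (1-p̃) log((1-p)/(1-p̃)) ≥ -((1-p̃)/(1-p)) H(p) + H(p̃)`. -/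
theorem stmt_5 (p p' : ℝ) (hp' : 0 < p') (hpp' : p' ≤ p) (hp : p < 1) :
    p' * Real.log (p / p') + (1 - p') * Real.log ((1 - p) / (1 - p')) ≥
      -((1 - p') / (1 - p)) * binEntropy p + binEntropy p' := by
  have h0 : 0 < p := lt_of_lt_of_le hp' hpp'
  have h1 : 0 < 1 - p := by linarith
  have h2 : 0 < 1 - p' := by linarith
  have hl : Real.log p ≤ 0 := Real.log_nonpos h0.le hp.le
  have hc : p' ≤ (1 - p') * p / (1 - p) := by
    rw [le_div_iff₀ h1]
    nlinarith
  have hm := mul_le_mul_of_nonpos_right hc hl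
  have e : -((1 - p') / (1 - p)) * binEntropy p =
      (1 - p') * p / (1 - p) * Real.log p + (1 - p') * Real.log (1 - p) := by
    unfold binEntropy
    field_simp
    ring
  rw [e, Real.log_div h0.ne' hp'.ne', Real.log_div h1.ne' h2.ne']
  unfold binEntropy
  linarith
end

section
/- (Lemma 2, m-SAM version.) Let E be the Euclidean space ℝ^d, let m ≥ 1, and for each i ∈ {1, …, m} let p_i : E → ℝ be a strictly positive twice continuously differentiable function with per-example loss ℓ_i(θ) = −log p_i(θ). Define the mini-batch loss L(θ) = (1/m) Σ_{i=1}^m ℓ_i(θ). Let ρ > 0 and θ ∈ E with ∇L(θ) ≠ 0 and ‖∇L(θ)‖ ≥ 1, and set θ̃ = θ + ρ ∇L(θ)/‖∇L(θ)‖. Suppose that for every point x on the segment joining θ and θ̃, every vector v ∈ E, and every i, the Hessian quadratic form satisfies ∇²ℓ_i(x)[v, v] ≥ −(1/ρ)‖v‖². Then the geometric means P = (Π_{i=1}^m p_i(θ))^{1/m} and P̃ = (Π_{i=1}^m p_i(θ̃))^{1/m} satisfy P̃ ≤ e^{−ρ/2} P. -/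
theorem aux_taylor {E : Type*} [NormedAddCommGroup E] [NormedSpace ℝ E] (f : E → ℝ)
    (hf : ContDiff ℝ 2 f) (x v : E) (C : ℝ)
    (h : ∀ t ∈ Set.Icc (0:ℝ) 1, iteratedFDeriv ℝ 2 f (x + t • v) ![v, v] ≥ -C) :
    f x + fderiv ℝ f x v - C / 2 ≤ f (x + v) := by
  have hline : ∀ t : ℝ, HasDerivAt (fun t : ℝ => x + t • v) v t := fun t => by
    simpa using ((hasDerivAt_id t).smul_const v).const_add x
  have hd1 : Differentiable ℝ f := hf.differentiable (by norm_num)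
  have hd2 : Differentiable ℝ (fderiv ℝ f) :=
    (hf.fderiv_right (m := 1) (by norm_num)).differentiable (by norm_num)
  have h1 : ∀ t : ℝ, HasDerivAt (fun t : ℝ => f (x + t • v)) (fderiv ℝ f (x + t • v) v) t :=
    fun t => (hd1 (x + t • v)).hasFDerivAt.comp_hasDerivAt t (hline t)
  have h2 : ∀ t : ℝ, HasDerivAt (fun t : ℝ => fderiv ℝ f (x + t • v) v)
      (fderiv ℝ (fderiv ℝ f) (x + t • v) v v) t := fun t => by
    have := (hd2 (x + t • v)).hasFDerivAt.comp_hasDerivAt t (hline t)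
    simpa using this.clm_apply (hasDerivAt_const t v)
  let G : ℝ → ℝ := fun t => fderiv ℝ f (x + t • v) v - fderiv ℝ f x v + C * t
  have hG : ∀ t, HasDerivAt G (fderiv ℝ (fderiv ℝ f) (x + t • v) v v + C) t := fun t => by
    have := ((h2 t).sub_const (fderiv ℝ f x v)).add ((hasDerivAt_id t).const_mul C)
    exact this.congr_deriv (by simp)
  have hGm : MonotoneOn G (Set.Icc 0 1) := by
    apply monotoneOn_of_deriv_nonneg (convex_Icc 0 1)
      (fun t _ => (hG t).continuousAt.continuousWithinAt)
      (fun t _ => (hG t).differentiableAt.differentiableWithinAt)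
    intro t ht
    rw [(hG t).deriv]
    have := h t (interior_subset ht)
    rw [iteratedFDeriv_two_apply] at this
    simp at this
    linarith
  have hG0 : G 0 = 0 := by simp [G]
  let g : ℝ → ℝ := fun t => f (x + t • v) - fderiv ℝ f x v * t + C / 2 * t ^ 2
  have hg : ∀ t, HasDerivAt g (G t) t := fun t => by
    have := ((h1 t).sub ((hasDerivAt_id t).const_mul (fderiv ℝ f x v))).add
      (((hasDerivAt_id t).pow 2).const_mul (C / 2))
    refine this.congr_deriv ?_
    simp [G]
    ring
  have hgm : MonotoneOn g (Set.Icc 0 1) := by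
    apply monotoneOn_of_deriv_nonneg (convex_Icc 0 1)
      (fun t _ => (hg t).continuousAt.continuousWithinAt)
      (fun t _ => (hg t).differentiableAt.differentiableWithinAt)
    intro t ht
    have ht' : t ∈ Set.Icc (0:ℝ) 1 := interior_subset ht
    rw [(hg t).deriv, ← hG0]
    exact hGm (by simp) ht' ht'.1
  have := hgm (by simp : (0:ℝ) ∈ Set.Icc (0:ℝ) 1) (by simp : (1:ℝ) ∈ Set.Icc (0:ℝ) 1) zero_le_one
  simp [g] at this
  linarith

/-- Lemma 2 (m-SAM version): for per-example losses `ℓᵢ = -log pᵢ` with `pᵢ > 0`,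
mini-batch loss `L(θ) = (1/m) Σᵢ ℓᵢ(θ)`, and the m-SAM step
`θ̃ = θ + ρ ∇L(θ)/‖∇L(θ)‖` with `‖∇L(θ)‖ ≥ 1`, under the per-example Hessian lower
bound `-(1/ρ)‖v‖²` on the segment joining `θ` and `θ̃`, the geometric means satisfy
`P̃ ≤ e^{-ρ/2} P`. -/
theorem stmt_9 {d m : ℕ} (hm : 1 ≤ m)
    (p : Fin m → EuclideanSpace ℝ (Fin d) → ℝ) (hp : ∀ i x, 0 < p i x)
    (hpC2 : ∀ i, ContDiff ℝ 2 (p i))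
    (ℓ : Fin m → EuclideanSpace ℝ (Fin d) → ℝ)
    (hℓ : ∀ i, ℓ i = fun x => -Real.log (p i x))
    (L : EuclideanSpace ℝ (Fin d) → ℝ)
    (hL : L = fun θ => (1 / (m : ℝ)) * ∑ i, ℓ i θ)
    (ρ : ℝ) (hρ : 0 < ρ) (θ θ' : EuclideanSpace ℝ (Fin d))
    (hgrad : gradient L θ ≠ 0) (hgradnorm : 1 ≤ ‖gradient L θ‖)
    (hθ' : θ' = θ + (ρ / ‖gradient L θ‖) • gradient L θ)
    (hHess : ∀ x ∈ segment ℝ θ θ', ∀ v : EuclideanSpace ℝ (Fin d), ∀ i,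
      iteratedFDeriv ℝ 2 (ℓ i) x ![v, v] ≥ -(1 / ρ) * ‖v‖ ^ 2) :
    (∏ i, p i θ') ^ ((m : ℝ)⁻¹) ≤ Real.exp (-ρ / 2) * (∏ i, p i θ) ^ ((m : ℝ)⁻¹) := by
  have hm0 : (0:ℝ) < m := by exact_mod_cast hm
  have hC : ∀ i, ContDiff ℝ 2 (ℓ i) := fun i => by
    rw [hℓ i]
    exact ((hpC2 i).log (fun x => (hp i x).ne')).neg
  have hdiff : ∀ i, DifferentiableAt ℝ (ℓ i) θ := fun i =>
    (hC i).differentiable (by norm_num) θ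
  have hn : 0 < ‖gradient L θ‖ := norm_pos_iff.2 hgrad
  obtain ⟨v, hv⟩ : ∃ v, v = (ρ / ‖gradient L θ‖) • gradient L θ := ⟨_, rfl⟩
  rw [← hv] at hθ'
  have hvn : ‖v‖ = ρ := by
    rw [hv, norm_smul, Real.norm_of_nonneg (by positivity)]
    field_simp
  have hT : ∀ i, ℓ i θ + fderiv ℝ (ℓ i) θ v - ρ / 2 ≤ ℓ i θ' := fun i => by
    rw [hθ']
    apply aux_taylor (ℓ i) (hC i) θ v ρ
    intro t ht
    have := hHess (θ + t • v) (by
      rw [segment_eq_image', hθ']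
      exact ⟨t, ht, by simp⟩) v i
    rw [hvn] at this
    have e : -(1 / ρ) * ρ ^ 2 = -ρ := by field_simp
    rwa [e] at this
  have hLd : HasFDerivAt L ((1 / (m:ℝ)) • ∑ i, fderiv ℝ (ℓ i) θ) θ := by
    rw [hL]
    exact (HasFDerivAt.fun_sum (fun i _ => (hdiff i).hasFDerivAt)).const_mul _
  have hLv : fderiv ℝ L θ v = ρ * ‖gradient L θ‖ := by
    have : inner ℝ (gradient L θ) v = fderiv ℝ L θ v := by
      simp [gradient]
    rw [← this, hv, inner_smul_right, real_inner_self_eq_norm_sq]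
    field_simp
  have hLv2 : (1 / (m:ℝ)) * ∑ i, fderiv ℝ (ℓ i) θ v = ρ * ‖gradient L θ‖ := by
    rw [← hLv, hLd.fderiv]
    simp
  have hsum := Finset.sum_le_sum (fun i (_ : i ∈ Finset.univ) => hT i)
  simp only [Finset.sum_sub_distrib, Finset.sum_add_distrib, Finset.sum_const,
    Finset.card_univ, Fintype.card_fin, nsmul_eq_mul] at hsum
  have hρg : ρ ≤ ρ * ‖gradient L θ‖ := le_mul_of_one_le_right hρ.le hgradnorm
  have hmul := mul_le_mul_of_nonneg_left hsum (by positivity : 0 ≤ 1 / (m:ℝ))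
  rw [mul_sub, mul_add, hLv2] at hmul
  have e2 : 1 / (m:ℝ) * (m * (ρ / 2)) = ρ / 2 := by field_simp
  rw [e2] at hmul
  have key : ∀ x, (∏ i, p i x) ^ ((m : ℝ)⁻¹) = Real.exp (-(1 / (m:ℝ) * ∑ i, ℓ i x)) := by
    intro x
    rw [Real.rpow_def_of_pos (Finset.prod_pos (fun i _ => hp i x)),
      Real.log_prod (fun i _ => (hp i x).ne')]
    congr 1
    simp only [hℓ, Finset.sum_neg_distrib]
    ring
  rw [key, key, ← Real.exp_add]
  apply Real.exp_le_exp.2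
  linarith
end

section
/- (Theorem 2, m-SAM version, as a real inequality.) Let m ≥ 1 and let p_1, …, p_m and p̃_1, …, p̃_m be real numbers in (0, 1). Define the geometric means P = (Π_{i=1}^m p_i)^{1/m} and P̃ = (Π_{i=1}^m p̃_i)^{1/m}, and suppose P̃ ≤ P. Then −(1/m) Σ_{i=1}^m log p̃_i ≥ −(1/m) Σ_{i=1}^m log p_i − λ H(P) + H(P̃), where λ = (1 − P̃)/(1 − P) and H is the binary entropy function. -/
/-- Theorem 2 (m-SAM version), as a real inequality: given `pᵢ, p̃ᵢ ∈ (0,1)` with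
geometric means `P = (Πᵢ pᵢ)^{1/m}` and `P̃ = (Πᵢ p̃ᵢ)^{1/m}` satisfying `P̃ ≤ P`,
the mini-batch cross-entropy losses satisfy
`-(1/m) Σᵢ log p̃ᵢ ≥ -(1/m) Σᵢ log pᵢ - λ H(P) + H(P̃)` with `λ = (1-P̃)/(1-P)`. -/
theorem stmt_10 {m : ℕ} (hm : 1 ≤ m) (p p' : Fin m → ℝ)
    (hp : ∀ i, p i ∈ Set.Ioo (0 : ℝ) 1) (hp' : ∀ i, p' i ∈ Set.Ioo (0 : ℝ) 1)
    (P P' : ℝ) (hP : P = (∏ i, p i) ^ ((m : ℝ)⁻¹)) (hP' : P' = (∏ i, p' i) ^ ((m : ℝ)⁻¹))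
    (hle : P' ≤ P) :
    -((1 / (m : ℝ)) * ∑ i, Real.log (p' i)) ≥
      -((1 / (m : ℝ)) * ∑ i, Real.log (p i))
        - (1 - P') / (1 - P) * binEntropy P + binEntropy P' := by
  have hm0 : (0 : ℝ) < m := by exact_mod_cast hm
  have key : ∀ q : Fin m → ℝ, (∀ i, q i ∈ Set.Ioo (0 : ℝ) 1) → ∀ Q : ℝ,
      Q = (∏ i, q i) ^ ((m : ℝ)⁻¹) →
      0 < Q ∧ Q < 1 ∧ Real.log Q = (1 / (m : ℝ)) * ∑ i, Real.log (q i) := by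
    intro q hq Q hQ
    have hpos : 0 < ∏ i, q i := Finset.prod_pos (fun i _ => (hq i).1)
    have hQ0 : 0 < Q := by rw [hQ]; exact Real.rpow_pos_of_pos hpos _
    have hlog : Real.log Q = (1 / (m : ℝ)) * ∑ i, Real.log (q i) := by
      rw [hQ, Real.log_rpow hpos, Real.log_prod (fun i _ => (hq i).1.ne'), one_div]
    refine ⟨hQ0, ?_, hlog⟩
    rw [← Real.log_neg_iff hQ0, hlog]
    apply mul_neg_of_pos_of_neg (by positivity)
    apply Finset.sum_neg
    · intro i _
      exact Real.log_neg (hq i).1 (hq i).2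
    · exact ⟨⟨0, hm⟩, Finset.mem_univ _⟩
  obtain ⟨ha0, ha1, hla⟩ := key p hp P hP
  obtain ⟨hb0, hb1, hlb⟩ := key p' hp' P' hP'
  rw [← hla, ← hlb]
  have h1 : Real.log P' ≤ Real.log P := Real.log_le_log hb0 hle
  have h2 : Real.log (1 - P) ≤ Real.log (1 - P') := Real.log_le_log (by linarith) (by linarith)
  have h3 : Real.log P < 0 := Real.log_neg ha0 ha1
  have ha : 0 < 1 - P := by linarith
  have hb : 0 < 1 - P' := by linarith
  have h4 : 1 ≤ (1 - P') / (1 - P) := by rw [le_div_iff₀ ha]; linarith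
  have e : (1 - P') / (1 - P) * binEntropy P =
      -((1 - P') / (1 - P)) * Real.log P + (1 - P') * Real.log P
        - (1 - P') * Real.log (1 - P) := by
    unfold binEntropy
    field_simp
    ring
  rw [e]
  unfold binEntropy
  nlinarith [mul_nonneg hb.le (sub_nonneg.2 h1), mul_nonneg hb.le (sub_nonneg.2 h2),
    mul_nonneg (sub_nonneg.2 h4) (neg_nonneg.2 h3.le)]
end

section
/- (Theorem 3, CSAM.) Let γ ∈ [0, 2] and let p, p̃ be real numbers with 1/2 < p̃ ≤ p < 1, and set λ = (1 − p̃)/(1 − p). Then the CSAM loss satisfies −(1 + p̃)^{−γ} log p̃ ≥ −log p − λ H(p) + (1 − γ/2) H(p̃), where H is the binary entropy function. -/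
theorem aux_mono (p q : ℝ) (hq : 1 / 2 < q) (hpq : q ≤ p) (hp : p < 1) :
    binEntropy q ≤ (1 - q) / (1 - p) * binEntropy p := by
  have hE : ∀ x, binEntropy x = Real.binEntropy x := by
    intro x
    rw [Real.binEntropy_eq_negMulLog_add_negMulLog_one_sub]
    simp only [binEntropy, Real.negMulLog]
    ring
  have ht : 0 < 1 - p := by linarith
  have hs : 0 < 1 - q := by linarith
  have ha : 0 ≤ (1 - p) / (1 - q) := by positivity
  have hb : 0 ≤ (p - q) / (1 - q) := div_nonneg (by linarith) hs.le
  have hab : (1 - p) / (1 - q) + (p - q) / (1 - q) = 1 := by field_simp; ring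
  have hq1 : q ∈ Set.Icc (0 : ℝ) 1 := ⟨by linarith, by linarith⟩
  have h11 : (1 : ℝ) ∈ Set.Icc (0 : ℝ) 1 := ⟨by norm_num, by norm_num⟩
  have hc := Real.strictConcave_binEntropy.concaveOn
  have h := hc.2 hq1 h11 ha hb hab
  simp only [smul_eq_mul, Real.binEntropy_one, mul_zero, add_zero] at h
  have e : (1 - p) / (1 - q) * q + (p - q) / (1 - q) * 1 = p := by field_simp; ring
  rw [e, ← hE, ← hE] at h
  calc binEntropy q = (1 - q) / (1 - p) * ((1 - p) / (1 - q) * binEntropy q) := by field_simp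
    _ ≤ _ := by gcongr

theorem aux_base (q : ℝ) (hq : 1 / 2 < q) (h1 : q < 1) :
    -Real.log q * Real.log (1 + q) ≤ binEntropy q / 2 := by
  have hl2 := Real.log_two_gt_d9
  have hl2' := Real.log_two_lt_d9
  have hL0 : 0 ≤ -Real.log q := by linarith [Real.log_nonpos (by linarith : 0 ≤ q) h1.le]
  have hL : q * (-Real.log q) ≤ 1 - q := by
    have := Real.one_sub_inv_le_log_of_pos (by linarith : 0 < q)
    have h2 := mul_le_mul_of_nonneg_left this (by linarith : 0 ≤ q)
    have h3 : q * (1 - q⁻¹) = q - 1 := by field_simp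
    linarith
  have hs : Real.log 2 ≤ -Real.log (1 - q) := by
    rw [← Real.log_inv]
    apply Real.log_le_log (by norm_num)
    rw [le_inv_comm₀ (by norm_num) (by linarith)]
    linarith
  have hA : 2 * Real.log (1 + q) ≤ q + q * Real.log 2 := by
    have e1 : 2 * Real.log (1 + q) = 2 * Real.log ((1 + q) / (3 / 2)) + Real.log 2 + Real.log (9 / 8) := by
      rw [Real.log_div (by linarith) (by norm_num), mul_sub]
      have : Real.log 2 + Real.log (9 / 8) = 2 * Real.log (3 / 2) := by
        rw [← Real.log_mul (by norm_num) (by norm_num),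
          show (2 : ℝ) * (9 / 8) = (3 / 2) ^ 2 by norm_num, Real.log_pow]
        norm_num
      linarith
    have e2 := Real.log_le_sub_one_of_pos (by linarith : 0 < (1 + q) / (3 / 2))
    have e3 := Real.log_le_sub_one_of_pos (by norm_num : (0 : ℝ) < 9 / 8)
    nlinarith
  have h5 : -Real.log q * (2 * Real.log (1 + q) - q) ≤ -Real.log q * (q * Real.log 2) :=
    mul_le_mul_of_nonneg_left (by linarith) hL0
  have h6 : (q * (-Real.log q)) * Real.log 2 ≤ (1 - q) * Real.log 2 :=
    mul_le_mul_of_nonneg_right hL (by linarith)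
  have h7 : (1 - q) * Real.log 2 ≤ (1 - q) * (-Real.log (1 - q)) :=
    mul_le_mul_of_nonneg_left hs (by linarith)
  unfold binEntropy
  nlinarith

/-- Theorem 3 (CSAM): for `γ ∈ [0,2]` and `1/2 < p̃ ≤ p < 1` with `λ = (1-p̃)/(1-p)`,
the CSAM loss satisfies `-(1+p̃)^{-γ} log p̃ ≥ -log p - λ H(p) + (1 - γ/2) H(p̃)`. -/
theorem stmt_11 (γ p p' : ℝ) (hγ0 : 0 ≤ γ) (hγ2 : γ ≤ 2)
    (hp' : 1 / 2 < p') (hpp' : p' ≤ p) (hp : p < 1) :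
    -((1 + p') ^ (-γ) * Real.log p') ≥
      -Real.log p - (1 - p') / (1 - p) * binEntropy p + (1 - γ / 2) * binEntropy p' := by
  have h1 := aux_mono p p' hp' hpp' hp
  have h2 := mul_le_mul_of_nonneg_left (aux_base p' hp' (by linarith)) hγ0
  have h3 : Real.log p' ≤ Real.log p := Real.log_le_log (by linarith) hpp'
  have h4 : 1 - γ * Real.log (1 + p') ≤ (1 + p') ^ (-γ) := by
    rw [Real.rpow_def_of_pos (by linarith)]
    have := Real.add_one_le_exp (Real.log (1 + p') * -γ)
    linarith
  have hL0 : 0 ≤ -Real.log p' := by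
    linarith [Real.log_nonpos (by linarith : 0 ≤ p') (by linarith)]
  have h5 := mul_le_mul_of_nonneg_right h4 hL0
  nlinarith
end

section
/- (Theorem 1, full 1-SAM version under the SAM hypotheses.) Let E be the Euclidean space ℝ^d, let p : E → ℝ be twice continuously differentiable with 0 < p(x) < 1 for all x, and define the cross-entropy loss ℓ(θ) = −log p(θ). Let ρ > 0 and θ ∈ E with ∇ℓ(θ) ≠ 0 and ‖∇ℓ(θ)‖ ≥ 1, and set θ̃ = θ + ρ ∇ℓ(θ)/‖∇ℓ(θ)‖. Suppose that for every point x on the segment joining θ and θ̃ and every vector v ∈ E, the Hessian quadratic form of ℓ satisfies ∇²ℓ(x)[v, v] ≥ −(1/ρ)‖v‖². Then, writing p = p(θ) and p̃ = p(θ̃) and λ = (1 − p̃)/(1 − p), the perturbed loss satisfies ℓ(θ̃) ≥ ℓ(θ) − λ H(p) + H(p̃) with λ ≥ 1, where H is the binary entropy function. -/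
/-- Theorem 1 (full 1-SAM version under the SAM hypotheses): for the cross-entropy loss
`ℓ = -log p` with `0 < p < 1`, under the SAM step `θ̃ = θ + ρ ∇ℓ(θ)/‖∇ℓ(θ)‖` with
`‖∇ℓ(θ)‖ ≥ 1` and the Hessian lower bound `-(1/ρ)‖v‖²` on the segment joining `θ`
and `θ̃`, writing `λ = (1 - p(θ̃))/(1 - p(θ))`, we have
`ℓ(θ̃) ≥ ℓ(θ) - λ H(p(θ)) + H(p(θ̃))` and `λ ≥ 1`. -/
theorem stmt_14 {d : ℕ} (p : EuclideanSpace ℝ (Fin d) → ℝ)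
    (hp : ∀ x, 0 < p x ∧ p x < 1) (hpC2 : ContDiff ℝ 2 p)
    (ℓ : EuclideanSpace ℝ (Fin d) → ℝ) (hℓ : ℓ = fun x => -Real.log (p x))
    (ρ : ℝ) (hρ : 0 < ρ) (θ θ' : EuclideanSpace ℝ (Fin d))
    (hgrad : gradient ℓ θ ≠ 0) (hgradnorm : 1 ≤ ‖gradient ℓ θ‖)
    (hθ' : θ' = θ + (ρ / ‖gradient ℓ θ‖) • gradient ℓ θ)
    (hHess : ∀ x ∈ segment ℝ θ θ', ∀ v : EuclideanSpace ℝ (Fin d),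
      iteratedFDeriv ℝ 2 ℓ x ![v, v] ≥ -(1 / ρ) * ‖v‖ ^ 2) :
    ℓ θ' ≥ ℓ θ - (1 - p θ') / (1 - p θ) * binEntropy (p θ) + binEntropy (p θ') ∧
      (1 - p θ') / (1 - p θ) ≥ 1 := by
  have hC : ContDiff ℝ 2 ℓ := by
    rw [hℓ]
    exact (hpC2.log (fun x => (hp x).1.ne')).neg
  have hd : Differentiable ℝ ℓ := hC.differentiable (by norm_num)
  have hd2 : Differentiable ℝ (fderiv ℝ ℓ) :=
    (hC.fderiv_right (m := 1) (by norm_num)).differentiable (by norm_num)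
  set g := gradient ℓ θ with hg
  have hgpos : 0 < ‖g‖ := by linarith
  set w := (ρ / ‖g‖) • g with hw
  have hwn : ‖w‖ = ρ := by
    rw [hw, norm_smul, Real.norm_of_nonneg (by positivity)]
    field_simp
  have hline : ∀ t : ℝ, HasDerivAt (fun t : ℝ => θ + t • w) w t := by
    intro t
    simpa using ((hasDerivAt_id t).smul_const w).const_add θ
  have h1 : ∀ t : ℝ, HasDerivAt (fun t : ℝ => ℓ (θ + t • w)) (fderiv ℝ ℓ (θ + t • w) w) t := by
    intro t
    exact (hd (θ + t • w)).hasFDerivAt.comp_hasDerivAt t (hline t)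
  have h2 : ∀ t : ℝ, HasDerivAt (fun t : ℝ => fderiv ℝ ℓ (θ + t • w) w)
      (fderiv ℝ (fderiv ℝ ℓ) (θ + t • w) w w) t := by
    intro t
    have := (hd2 (θ + t • w)).hasFDerivAt.comp_hasDerivAt t (hline t)
    simpa using this.clm_apply (hasDerivAt_const t w)
  have h3 : ∀ t : ℝ, HasDerivAt (fun t : ℝ => fderiv ℝ ℓ (θ + t • w) w + t * ρ)
      (fderiv ℝ (fderiv ℝ ℓ) (θ + t • w) w w + ρ) t := by
    intro t
    have h4 : HasDerivAt (fun t : ℝ => t * ρ) ρ t := by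
      simpa using (hasDerivAt_id t).mul_const ρ
    exact (h2 t).add h4
  have hmono : MonotoneOn (fun t : ℝ => fderiv ℝ ℓ (θ + t • w) w + t * ρ) (Set.Icc 0 1) := by
    apply monotoneOn_of_deriv_nonneg (convex_Icc 0 1)
    · exact fun t _ => (h3 t).continuousAt.continuousWithinAt
    · exact fun t _ => (h3 t).differentiableAt.differentiableWithinAt
    · intro t ht
      rw [interior_Icc] at ht
      rw [(h3 t).deriv]
      have hseg : θ + t • w ∈ segment ℝ θ θ' := by
        rw [segment_eq_image']
        exact ⟨t, ⟨ht.1.le, ht.2.le⟩, by simp [hθ']⟩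
      have := hHess _ hseg w
      rw [iteratedFDeriv_two_apply, hwn] at this
      have e : -(1 / ρ) * ρ ^ 2 = -ρ := by field_simp
      rw [e] at this
      simp at this
      linarith
  have h0 : fderiv ℝ ℓ θ w = ρ * ‖g‖ := by
    have : fderiv ℝ ℓ θ w = inner ℝ g w := by
      rw [hg, gradient, InnerProductSpace.toDual_symm_apply]
    rw [this, hw, inner_smul_right, real_inner_self_eq_norm_sq]
    field_simp
  have hmono2 : MonotoneOn (fun t : ℝ => ℓ (θ + t • w)) (Set.Icc 0 1) := by
    apply monotoneOn_of_deriv_nonneg (convex_Icc 0 1)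
    · exact fun t _ => (h1 t).continuousAt.continuousWithinAt
    · exact fun t _ => (h1 t).differentiableAt.differentiableWithinAt
    · intro t ht
      rw [interior_Icc] at ht
      rw [(h1 t).deriv]
      have := hmono (Set.left_mem_Icc.2 zero_le_one) ⟨ht.1.le, ht.2.le⟩ ht.1.le
      simp only [zero_smul, add_zero, zero_mul, h0] at this
      nlinarith [ht.2]
  have hle : ℓ θ ≤ ℓ θ' := by
    have := hmono2 (Set.left_mem_Icc.2 zero_le_one) (Set.right_mem_Icc.2 zero_le_one) zero_le_one
    simpa [hθ'] using this
  obtain ⟨ha0, ha1⟩ := hp θ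
  obtain ⟨hb0, hb1⟩ := hp θ'
  simp only [hℓ] at hle ⊢
  clear_value g w
  generalize p θ = a at *
  generalize p θ' = b at *
  have hlog : Real.log b ≤ Real.log a := by linarith
  have hba : b ≤ a := (Real.log_le_log_iff hb0 ha0).1 hlog
  have hlam : (1 - b) / (1 - a) ≥ 1 := by
    rw [ge_iff_le, le_div_iff₀ (by linarith)]; linarith
  refine ⟨?_, hlam⟩
  have hl1 : Real.log (1 - a) ≤ Real.log (1 - b) := Real.log_le_log (by linarith) (by linarith)
  have hla : Real.log a ≤ 0 := Real.log_nonpos ha0.le ha1.le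
  unfold binEntropy
  set L := (1 - b) / (1 - a) with hL
  have hLm : L * (1 - a) = 1 - b := by
    rw [hL]; exact div_mul_cancel₀ _ (by linarith)
  have e1 : L * (-a * Real.log a - (1 - a) * Real.log (1 - a))
      = - (L * Real.log a) + (1 - b) * Real.log a - (1 - b) * Real.log (1 - a) := by
    rw [← hLm]; ring
  rw [e1]
  nlinarith [mul_nonneg (sub_nonneg.2 hb1.le) (sub_nonneg.2 hl1),
    mul_nonneg (sub_nonneg.2 hb1.le) (sub_nonneg.2 hlog),
    mul_nonneg (sub_nonneg.2 hlam) (neg_nonneg.2 hla)]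
end
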